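/- Let a > 0, n ∈ ℕ with n ≥ 1, m ∈ ℕ₀, and r ∈ {0,...,n-1}. Let c_{k,m} denote the Taylor coefficients at z = -m of the analytic extension of z ↦ (-1)^m (z+m) Γ(z), i.e. Γ(z) = ((-1)^m/(z+m)) Σ_{k=0}^∞ c_{k,m} (z+m)^k near z = -m. Then lim_{s → -a-m} (d^r/ds^r) [(s+a+m) Γ(a+s)]^n = Σ_b r! n! (-1)^{mn} c_{1,m}^{b₁} ⋯ c_{r,m}^{b_r} / ((n-l)! (m!)^{n-l} b₁! b₂! ⋯ b_r!), where the sum is over all tuples (b₁,...,b_r) of nonnegative integers with b₁ + 2b₂ + ⋯ + r b_r = r and l = b₁ + b₂ + ⋯ + b_r. -/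

import Mathlib

open MeasureTheory Set Filter Topology

/-- The finite set of tuples `(b₁, …, b_r)` of nonnegative integers with
`b₁ + 2b₂ + ⋯ + r·b_r = r` (encoded as functions `Fin r → ℕ`, where `b i` is `b_{i+1}`). -/
noncomputable def partitionTuples (r : ℕ) : Finset (Fin r → ℕ) :=
  (Fintype.piFinset fun _ : Fin r => Finset.range (r + 1)).filter
    fun b => ∑ i, (i.1 + 1) * b i = r

theorem aux_gamma (m : ℕ) : Tendsto (fun z : ℂ => (z + m) * Complex.Gamma z) (𝓝[≠] (-(m:ℂ)))
    (𝓝 ((-1 : ℂ) ^ m / (m.factorial : ℂ))) := by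
  induction m with
  | zero => simpa using Complex.tendsto_self_mul_Gamma_nhds_zero
  | succ k ih =>
    have hk : (-((k + 1 : ℕ) : ℂ)) ≠ 0 := by
      rw [neg_ne_zero]; exact_mod_cast Nat.succ_ne_zero k
    have h1 : Tendsto (fun z : ℂ => z + 1) (𝓝[≠] (-((k + 1 : ℕ) : ℂ))) (𝓝[≠] (-(k:ℂ))) := by
      apply tendsto_nhdsWithin_of_tendsto_nhds_of_eventually_within
      · have : ContinuousAt (fun z : ℂ => z + 1) (-((k + 1 : ℕ) : ℂ)) := by fun_prop
        have h := this.tendsto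
        have e : (-((k + 1 : ℕ) : ℂ)) + 1 = -(k : ℂ) := by push_cast; ring
        rw [e] at h
        exact h.mono_left nhdsWithin_le_nhds
      · filter_upwards [self_mem_nhdsWithin] with z hz h
        apply hz
        simp only [mem_singleton_iff] at h ⊢
        push_cast
        linear_combination h
    have h2 : Tendsto (fun z : ℂ => z) (𝓝[≠] (-((k + 1 : ℕ) : ℂ))) (𝓝 (-((k + 1 : ℕ) : ℂ))) :=
      tendsto_id.mono_left nhdsWithin_le_nhds
    have h3 := (ih.comp h1).div h2 hk
    have e : (-1 : ℂ) ^ k / (k.factorial : ℂ) / (-((k + 1 : ℕ) : ℂ)) =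
        (-1 : ℂ) ^ (k + 1) / ((k + 1).factorial : ℂ) := by
      rw [Nat.factorial_succ, div_div, pow_succ, div_eq_div_iff]
      · push_cast; ring
      · exact mul_ne_zero (by exact_mod_cast k.factorial_ne_zero) hk
      · exact_mod_cast mul_ne_zero (Nat.succ_ne_zero k) k.factorial_ne_zero
    rw [e] at h3
    refine h3.congr' ?_
    have hz0 : ∀ᶠ z in 𝓝[≠] (-((k + 1 : ℕ) : ℂ)), z ≠ 0 :=
      (eventually_ne_nhds hk).filter_mono nhdsWithin_le_nhds
    filter_upwards [hz0] with z hz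
    simp only [Function.comp, Pi.div_apply]
    rw [Complex.Gamma_add_one z hz]
    push_cast
    field_simp
    ring

theorem aux_coeff (c : ℕ → ℂ) (n r : ℕ) (hr : r ≤ n) :
    PowerSeries.coeff r ((PowerSeries.mk c) ^ n) =
      ∑ b ∈ partitionTuples r, (n.factorial : ℂ) * (c 0) ^ (n - ∑ i, b i) *
        (∏ i : Fin r, (c (i.1 + 1)) ^ (b i)) /
        (((n - ∑ i, b i).factorial : ℂ) * ∏ i : Fin r, ((b i).factorial : ℂ)) := by
  classical
  have h0 : PowerSeries.coeff r ((PowerSeries.mk c) ^ n) =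
      Polynomial.coeff ((∑ i : Fin (r + 1), Polynomial.monomial i.1 (c i.1)) ^ n) r := by
    have h := PowerSeries.trunc_trunc_pow (PowerSeries.mk c) (r + 1) n
    have h' := congrArg (fun p => Polynomial.coeff p r) h
    simp only [PowerSeries.coeff_trunc, Nat.lt_succ_self, if_true] at h'
    rw [← h', ← Polynomial.coe_pow, Polynomial.coeff_coe]
    congr 2
    rw [← Finset.sum_range (fun i => Polynomial.monomial i (c i))]
    ext j
    simp [PowerSeries.coeff_trunc, Polynomial.coeff_monomial]
  rw [h0, Finset.sum_pow_eq_sum_piAntidiag, Polynomial.finsetSum_coeff]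
  have h1 : ∀ k : Fin (r + 1) → ℕ,
      Polynomial.coeff ((Nat.multinomial Finset.univ k : Polynomial ℂ) *
        ∏ i : Fin (r + 1), (Polynomial.monomial i.1 (c i.1)) ^ (k i)) r =
      if ∑ i : Fin (r + 1), i.1 * k i = r then
        (Nat.multinomial Finset.univ k : ℂ) * ∏ i : Fin (r + 1), (c i.1) ^ (k i) else 0 := by
    intro k
    have : ∏ i : Fin (r + 1), (Polynomial.monomial i.1 (c i.1)) ^ (k i) =
        Polynomial.monomial (∑ i : Fin (r + 1), i.1 * k i) (∏ i : Fin (r + 1), (c i.1) ^ (k i)) := by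
      simp_rw [Polynomial.monomial_pow, ← Polynomial.C_mul_X_pow_eq_monomial,
        Finset.prod_mul_distrib, Finset.prod_pow_eq_pow_sum, map_prod]
    rw [this, Polynomial.coeff_natCast_mul, Polynomial.coeff_monomial]
    split_ifs <;> simp
  simp_rw [h1]
  rw [← Finset.sum_filter]
  have hle : ∀ b : Fin r → ℕ, ∑ i, (i.1 + 1) * b i = r → ∑ i, b i ≤ n := by
    intro b hb
    refine le_trans (le_trans ?_ hb.le) hr
    exact Finset.sum_le_sum fun i _ => Nat.le_mul_of_pos_left _ (Nat.succ_pos _)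
  symm
  refine Finset.sum_bij' (fun b _ => Fin.cons (n - ∑ i, b i) b) (fun k _ => Fin.tail k)
    ?_ ?_ ?_ ?_ ?_
  · intro b hb
    simp only [partitionTuples, Finset.mem_filter] at hb
    have := hle b hb.2
    simp only [Finset.mem_filter, Finset.mem_piAntidiag, Fin.sum_univ_succ]
    simp only [Fin.cons_zero, Fin.cons_succ, Fin.val_succ, Fin.val_zero, zero_mul, zero_add]
    refine ⟨⟨by omega, by simp⟩, hb.2⟩
  · intro k hk
    simp only [Finset.mem_filter, Finset.mem_piAntidiag, Fin.sum_univ_succ, Fin.val_succ,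
      Fin.val_zero, zero_mul, zero_add] at hk
    simp only [partitionTuples, Finset.mem_filter, Fintype.mem_piFinset, Finset.mem_range, Fin.tail]
    refine ⟨fun i => ?_, hk.2⟩
    have h := Finset.single_le_sum (f := fun i : Fin r => (i.1 + 1) * k i.succ)
      (fun _ _ => Nat.zero_le _) (Finset.mem_univ i)
    have h2 : k i.succ ≤ (i.1 + 1) * k i.succ := Nat.le_mul_of_pos_left _ (Nat.succ_pos _)
    omega
  · intro b hb
    simp
  · intro k hk
    simp only [Finset.mem_filter, Finset.mem_piAntidiag, Fin.sum_univ_succ] at hk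
    have : n - ∑ i, Fin.tail k i = k 0 := by
      simp only [Fin.tail]; omega
    rw [this, Fin.cons_self_tail]
  · intro b hb
    simp only [partitionTuples, Finset.mem_filter] at hb
    have hb' := hle b hb.2
    have hs := Nat.multinomial_spec (Finset.univ : Finset (Fin (r + 1)))
      (Fin.cons (n - ∑ i, b i) b)
    simp only [Fin.prod_univ_succ, Fin.sum_univ_succ, Fin.cons_zero, Fin.cons_succ] at hs
    rw [Nat.sub_add_cancel hb'] at hs
    simp only [Fin.prod_univ_succ, Fin.cons_zero, Fin.cons_succ, Fin.val_succ, Fin.val_zero]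
    rw [← hs]
    have hne : (((n - ∑ i, b i).factorial : ℂ) * ∏ i : Fin r, ((b i).factorial : ℂ)) ≠ 0 :=
      mul_ne_zero (by exact_mod_cast Nat.factorial_ne_zero _)
        (Finset.prod_ne_zero_iff.2 fun i _ => by exact_mod_cast Nat.factorial_ne_zero _)
    rw [div_eq_iff hne]
    push_cast
    ring

noncomputable def auxT (f : ℂ → ℂ) (x : ℂ) : PowerSeries ℂ :=
  PowerSeries.mk fun k => iteratedDeriv k f x / (k.factorial : ℂ)

theorem auxT_mul {f g : ℂ → ℂ} {x : ℂ} (hf : AnalyticAt ℂ f x) (hg : AnalyticAt ℂ g x) :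
    auxT (f * g) x = auxT f x * auxT g x := by
  ext k
  rw [PowerSeries.coeff_mul, Finset.Nat.sum_antidiagonal_eq_sum_range_succ_mk]
  simp only [auxT, PowerSeries.coeff_mk]
  rw [iteratedDeriv_mul hf.contDiffAt hg.contDiffAt, Finset.sum_div]
  refine Finset.sum_congr rfl fun i hi => ?_
  have hik : i ≤ k := Nat.lt_succ_iff.1 (Finset.mem_range.1 hi)
  rw [Nat.cast_choose ℂ hik]
  have h1 : (k.factorial : ℂ) ≠ 0 := by exact_mod_cast k.factorial_ne_zero
  have h2 : (i.factorial : ℂ) ≠ 0 := by exact_mod_cast i.factorial_ne_zero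
  have h3 : ((k - i).factorial : ℂ) ≠ 0 := by exact_mod_cast (k - i).factorial_ne_zero
  field_simp

theorem auxT_pow {f : ℂ → ℂ} {x : ℂ} (hf : AnalyticAt ℂ f x) (n : ℕ) :
    auxT (f ^ n) x = (auxT f x) ^ n := by
  induction n with
  | zero =>
    ext k
    simp only [auxT, pow_zero, PowerSeries.coeff_mk, PowerSeries.coeff_one]
    have : (1 : ℂ → ℂ) = fun _ => 1 := rfl
    rw [this, iteratedDeriv_const]
    split_ifs with h
    · simp [h]
    · simp
  | succ n ih => rw [pow_succ, pow_succ, auxT_mul (hf.pow n) hf, ih]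

theorem aux_series (c : ℕ → ℂ) (w : ℂ) (hw : w ≠ 0) (h : Summable fun k => c k * w ^ k) :
    AnalyticAt ℂ (fun w => ∑' k, c k * w ^ k) 0 ∧
      auxT (fun w => ∑' k, c k * w ^ k) 0 = PowerSeries.mk c := by
  set p := FormalMultilinearSeries.ofScalars ℂ c with hp
  have hrad : (‖w‖₊ : ENNReal) ≤ p.radius := by
    apply p.le_radius_of_tendsto (l := 0)
    have := h.tendsto_atTop_zero.norm
    simpa [hp, FormalMultilinearSeries.ofScalars_norm] using this
  have hpos : 0 < p.radius := lt_of_lt_of_le (by simpa using hw) hrad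
  have hF := p.hasFPowerSeriesOnBall hpos
  have hs : p.sum = fun w => ∑' k, c k * w ^ k := by
    have := FormalMultilinearSeries.ofScalarsSum_eq_tsum (E := ℂ) c
    simpa [FormalMultilinearSeries.ofScalarsSum] using this
  rw [hs] at hF
  refine ⟨hF.analyticAt, ?_⟩
  ext k
  simp only [auxT, PowerSeries.coeff_mk]
  rw [iteratedDeriv_eq_iteratedFDeriv, ← hF.factorial_smul 1 k]
  have h1 : (k.factorial : ℂ) ≠ 0 := by exact_mod_cast k.factorial_ne_zero
  rw [div_eq_iff h1]
  simp [hp, FormalMultilinearSeries.ofScalars_apply_eq, mul_comm]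

/-- Let `a > 0`, `n ≥ 1`, `m ∈ ℕ`, `0 ≤ r ≤ n-1`, and let `c k m` be the
Taylor coefficients at `z = -m` of the analytic extension of `z ↦ (-1)^m (z+m) Γ(z)`, i.e.
`Γ(z) = ((-1)^m/(z+m)) Σ_k c_{k,m} (z+m)^k` near `z = -m`. Then
`lim_{s→-a-m} (d^r/ds^r)[(s+a+m)Γ(a+s)]^n
   = Σ_b r! n! (-1)^{mn} c_{1,m}^{b₁} ⋯ c_{r,m}^{b_r} / ((n-l)! (m!)^{n-l} b₁!⋯b_r!)`,
summed over tuples `b` with `b₁ + 2b₂ + ⋯ + r·b_r = r`, where `l = b₁ + ⋯ + b_r`. -/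
theorem dixon_residue_limit_left_factor (a : ℝ) (ha : 0 < a) (n : ℕ) (hn : 1 ≤ n)
    (m : ℕ) (r : ℕ) (hr : r ≤ n - 1)
    (c : ℕ → ℕ → ℂ)
    (hc : ∀ m' : ℕ, ∀ᶠ z in 𝓝[≠] (-(m' : ℂ)),
      HasSum (fun k : ℕ => c k m' * (z + m') ^ k)
        ((-1 : ℂ) ^ m' * (z + m') * Complex.Gamma z)) :
    Tendsto
      (fun s : ℂ => iteratedDeriv r
        (fun z : ℂ => ((z + a + m) * Complex.Gamma (a + z)) ^ n) s)
      (𝓝[≠] (-(a : ℂ) - m))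
      (𝓝 (∑ b ∈ partitionTuples r,
        (r.factorial : ℂ) * (n.factorial : ℂ) * (-1 : ℂ) ^ (m * n) *
          (∏ i : Fin r, (c (i.1 + 1) m) ^ (b i)) /
          (((n - ∑ i, b i).factorial : ℂ) * ((m.factorial : ℂ)) ^ (n - ∑ i, b i) *
            ∏ i : Fin r, ((b i).factorial : ℂ)))) := by
  classical
  set F : ℂ → ℂ := fun w => ∑' k, c k m * w ^ k with hFdef
  set x₀ : ℂ := -(a : ℂ) - m with hx₀
  have hc' := hc m
  -- a nonzero point of convergence
  obtain ⟨hFan, hFT⟩ : AnalyticAt ℂ F 0 ∧ auxT F 0 = PowerSeries.mk (fun k => c k m) := by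
    obtain ⟨z, hz, hz'⟩ := (hc'.and self_mem_nhdsWithin).exists
    refine aux_series (fun k => c k m) (z + m) ?_ hz.summable
    intro h
    exact hz' (eq_neg_of_add_eq_zero_left h)
  have hF0 : F 0 = c 0 m := by
    have := congrArg (PowerSeries.coeff 0) hFT
    simpa [auxT] using this
  -- the leading coefficient
  have hc0 : c 0 m = 1 / (m.factorial : ℂ) := by
    have h1 : Tendsto (fun z : ℂ => F (z + m)) (𝓝[≠] (-(m : ℂ))) (𝓝 (c 0 m)) := by
      have hcont : ContinuousAt (fun z : ℂ => F (z + m)) (-(m : ℂ)) := by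
        apply ContinuousAt.comp (g := F)
        · rw [neg_add_cancel]; exact hFan.continuousAt
        · fun_prop
      have := hcont.tendsto
      simp only [neg_add_cancel, hF0] at this
      exact this.mono_left nhdsWithin_le_nhds
    have h2 := (aux_gamma m).const_mul ((-1 : ℂ) ^ m)
    have h3 : (fun z : ℂ => (-1 : ℂ) ^ m * ((z + m) * Complex.Gamma z)) =ᶠ[𝓝[≠] (-(m : ℂ))]
        (fun z : ℂ => F (z + m)) := by
      filter_upwards [hc'] with z hz
      rw [hFdef]; simp only; rw [hz.tsum_eq]; ring
    have h4 := tendsto_nhds_unique h1 (h2.congr' h3)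
    rw [h4, ← mul_div_assoc, ← mul_pow]
    norm_num
  set H : ℂ → ℂ := fun s => (-1 : ℂ) ^ (m * n) * (F ^ n) (s + (a + m)) with hH
  have hHan : AnalyticAt ℂ H x₀ := by
    apply analyticAt_const.mul
    apply AnalyticAt.fun_comp (g := F ^ n)
    · have : x₀ + (a + m) = 0 := by rw [hx₀]; ring
      rw [this]; exact hFan.pow n
    · fun_prop
  have hshift : Tendsto (fun s : ℂ => a + s) (𝓝[≠] x₀) (𝓝[≠] (-(m : ℂ))) := by
    apply tendsto_nhdsWithin_of_tendsto_nhds_of_eventually_within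
    · have : ContinuousAt (fun z : ℂ => a + z) x₀ := by fun_prop
      have h := this.tendsto
      have e : a + x₀ = -(m : ℂ) := by rw [hx₀]; ring
      rw [e] at h
      exact h.mono_left nhdsWithin_le_nhds
    · filter_upwards [self_mem_nhdsWithin] with z hz h
      apply hz
      simp only [mem_singleton_iff] at h ⊢
      rw [hx₀]
      linear_combination h
  have hEq : ∀ᶠ s in 𝓝[≠] x₀, ((s + a + m) * Complex.Gamma (a + s)) ^ n = H s := by
    filter_upwards [hshift.eventually hc'] with s hs
    have h1 : F (s + (a + m)) = (-1 : ℂ) ^ m * (a + s + m) * Complex.Gamma (a + s) := by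
      rw [← hs.tsum_eq, hFdef]
      simp only
      congr 1; ext k; congr 2; ring
    simp only [hH, Pi.pow_apply]
    rw [h1, pow_mul, ← mul_pow, ← mul_assoc, ← mul_assoc, ← mul_pow]
    norm_num
    congr 2; ring
  have hder : (fun s : ℂ => iteratedDeriv r H s) =ᶠ[𝓝[≠] x₀] (fun s : ℂ => iteratedDeriv r
        (fun z : ℂ => ((z + a + m) * Complex.Gamma (a + z)) ^ n) s) := by
    have h2 := eventually_eventually_nhdsWithin.2 hEq
    filter_upwards [h2, self_mem_nhdsWithin] with s hs hs'
    rw [IsOpen.nhdsWithin_eq isOpen_compl_singleton hs'] at hs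
    exact (Filter.EventuallyEq.iteratedDeriv_eq r hs).symm
  refine Tendsto.congr' hder ?_
  have hcont : ContinuousAt (fun s : ℂ => iteratedDeriv r H s) x₀ := by
    have := (hHan.iterated_deriv r).continuousAt
    rwa [← iteratedDeriv_eq_iterate] at this
  have hval : iteratedDeriv r H x₀ = (-1 : ℂ) ^ (m * n) *
      ((r.factorial : ℂ) * PowerSeries.coeff r ((PowerSeries.mk (fun k => c k m)) ^ n)) := by
    rw [← hFT, ← auxT_pow hFan, hH]
    rw [iteratedDeriv_const_mul_field, iteratedDeriv_comp_add_const]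
    have : x₀ + (a + m) = 0 := by rw [hx₀]; ring
    have h1 : (r.factorial : ℂ) ≠ 0 := by exact_mod_cast r.factorial_ne_zero
    simp only [this, auxT, PowerSeries.coeff_mk]
    field_simp
  have key := hcont.tendsto.mono_left (nhdsWithin_le_nhds (s := {x₀}ᶜ))
  rw [hval, aux_coeff _ n r (by omega), Finset.mul_sum, Finset.mul_sum] at key
  convert key using 2
  refine Finset.sum_congr rfl fun b _ => ?_
  rw [hc0, one_div, inv_pow]
  have h1 : (((m.factorial : ℂ)) ^ (n - ∑ i, b i)) ≠ 0 :=
    pow_ne_zero _ (by exact_mod_cast m.factorial_ne_zero)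
  have h2 : (∏ i : Fin r, ((b i).factorial : ℂ)) ≠ 0 :=
    Finset.prod_ne_zero_iff.2 fun i _ => by exact_mod_cast Nat.factorial_ne_zero _
  have h3 : ((n - ∑ i, b i).factorial : ℂ) ≠ 0 := by exact_mod_cast Nat.factorial_ne_zero _
  field_simp
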